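/- Let (a_1,…,a_n) be an open meandric permutation of order n, let 1 ≤ k ≤ n, and let (b_1,…,b_m) be an open meandric permutation of odd order m. Define a sequence (c_1,…,c_{n+m−1}) by: for 1 ≤ i < k, c_i = a_i if a_i < a_k and c_i = a_i + m − 1 if a_i > a_k; for 1 ≤ j ≤ m, c_{k−1+j} = a_k − 1 + b_j; and for k < i ≤ n, c_{i+m−1} = a_i if a_i < a_k and c_{i+m−1} = a_i + m − 1 if a_i > a_k. Then (c_1,…,c_{n+m−1}) is an open meandric permutation of order n+m−1 (the insert of the second meander into the first at the point a_k). -/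

import Mathlib

open Filter

/-- `x` lies strictly between `p` and `q`. -/
def StrictlyBetween (p q x : ℕ) : Prop := min p q < x ∧ x < max p q

/-- Two arcs `{p, q}` and `{r, s}` cross if exactly one of `r`, `s` lies strictly
between `p` and `q`. -/
def ArcsCross (p q r s : ℕ) : Prop :=
  Xor' (StrictlyBetween p q r) (StrictlyBetween p q s)

/-- `a` (with one-based indexing, only the values `a 1, …, a n` being relevant)
is an open meandric permutation of order `n`: it is a permutation of `{1, …, n}`
with `a i ≡ i (mod 2)`, whose upper arcs (pairs `{a i, a (i+1)}` for odd `i < n`)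
are pairwise noncrossing, whose lower arcs (pairs `{a i, a (i+1)}` for even
`1 ≤ i < n`) are pairwise noncrossing, such that no lower arc strictly encloses
`a 1`, and no lower arc (if `n` is even) resp. upper arc (if `n` is odd)
strictly encloses `a n`. -/
def IsOpenMeandricPerm (n : ℕ) (a : ℕ → ℕ) : Prop :=
  1 ≤ n ∧
  (∀ i, 1 ≤ i → i ≤ n → 1 ≤ a i ∧ a i ≤ n) ∧
  (∀ i j, 1 ≤ i → i ≤ n → 1 ≤ j → j ≤ n → a i = a j → i = j) ∧
  (∀ i, 1 ≤ i → i ≤ n → a i % 2 = i % 2) ∧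
  (∀ i j, Odd i → i < n → Odd j → j < n →
      ¬ ArcsCross (a i) (a (i + 1)) (a j) (a (j + 1))) ∧
  (∀ i j, Even i → 1 ≤ i → i < n → Even j → 1 ≤ j → j < n →
      ¬ ArcsCross (a i) (a (i + 1)) (a j) (a (j + 1))) ∧
  (∀ i, Even i → 1 ≤ i → i < n → ¬ StrictlyBetween (a i) (a (i + 1)) (a 1)) ∧
  (if Even n
    then ∀ i, Even i → 1 ≤ i → i < n → ¬ StrictlyBetween (a i) (a (i + 1)) (a n)
    else ∀ i, Odd i → i < n → ¬ StrictlyBetween (a i) (a (i + 1)) (a n))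

/-- An open meandric permutation of order `n` is irreducible if there are no
indices `1 ≤ k₁ < k₂ ≤ n` with `2 < k₂ - k₁ ≤ n - 2` such that the values
`a k₁, …, a k₂` form an interval of integers, i.e. their max minus their min
equals `k₂ - k₁`. -/
def IsIrreducibleMeander (n : ℕ) (a : ℕ → ℕ) : Prop :=
  ¬ ∃ k₁ k₂ : ℕ, ∃ h : k₁ < k₂, 1 ≤ k₁ ∧ k₂ ≤ n ∧ 2 < k₂ - k₁ ∧ k₂ - k₁ ≤ n - 2 ∧
    (Finset.Icc k₁ k₂).sup' (Finset.nonempty_Icc.mpr h.le) a -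
      (Finset.Icc k₁ k₂).inf' (Finset.nonempty_Icc.mpr h.le) a = k₂ - k₁

/-- An open meandric permutation of order `n` is prime if `a 1 ≠ 1` and no proper
initial segment `a 1, …, a j` (`2 ≤ j < n`) is a permutation of `{1, …, j}`. -/
def IsPrimeMeander (n : ℕ) (a : ℕ → ℕ) : Prop :=
  a 1 ≠ 1 ∧ ¬ ∃ j, 2 ≤ j ∧ j < n ∧ (Finset.Icc 1 j).image a = Finset.Icc 1 j

/-- `a` (with one-based indexing) is a closed meandric permutation of order `n`:
a permutation of `{1, …, 2n}` with `a 1 = 1`, `a i ≡ i (mod 2)`, pairwise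
noncrossing upper arcs `{a i, a (i+1)}` (odd `i < 2n`) and pairwise noncrossing
lower arcs, the latter being the `{a i, a (i+1)}` for even `1 ≤ i < 2n` together
with the wrap-around arc `{a (2n), a 1}`. -/
def IsClosedMeandricPerm (n : ℕ) (a : ℕ → ℕ) : Prop :=
  1 ≤ n ∧ a 1 = 1 ∧
  (∀ i, 1 ≤ i → i ≤ 2 * n → 1 ≤ a i ∧ a i ≤ 2 * n) ∧
  (∀ i j, 1 ≤ i → i ≤ 2 * n → 1 ≤ j → j ≤ 2 * n → a i = a j → i = j) ∧
  (∀ i, 1 ≤ i → i ≤ 2 * n → a i % 2 = i % 2) ∧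
  (∀ i j, Odd i → i < 2 * n → Odd j → j < 2 * n →
      ¬ ArcsCross (a i) (a (i + 1)) (a j) (a (j + 1))) ∧
  (∀ i j, Even i → 1 ≤ i → i < 2 * n → Even j → 1 ≤ j → j < 2 * n →
      ¬ ArcsCross (a i) (a (i + 1)) (a j) (a (j + 1))) ∧
  (∀ i, Even i → 1 ≤ i → i < 2 * n →
      ¬ ArcsCross (a i) (a (i + 1)) (a (2 * n)) (a 1) ∧
      ¬ ArcsCross (a (2 * n)) (a 1) (a i) (a (i + 1)))

/-- `M n`: the number of open meandric permutations of order `n` (each counted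
once via the normalization `a i = 0` outside `{1, …, n}`). -/
noncomputable def openMeanderCount (n : ℕ) : ℕ :=
  Set.ncard {a : ℕ → ℕ | IsOpenMeandricPerm n a ∧ ∀ i, i < 1 ∨ n < i → a i = 0}

/-- `M^{Irr} n`: the number of irreducible open meandric permutations of order `n`. -/
noncomputable def irrMeanderCount (n : ℕ) : ℕ :=
  Set.ncard {a : ℕ → ℕ | IsOpenMeandricPerm n a ∧ IsIrreducibleMeander n a ∧
    ∀ i, i < 1 ∨ n < i → a i = 0}

/-- `M^{(P)} n`: the number of prime open meandric permutations of order `n`. -/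
noncomputable def primeMeanderCount (n : ℕ) : ℕ :=
  Set.ncard {a : ℕ → ℕ | IsOpenMeandricPerm n a ∧ IsPrimeMeander n a ∧
    ∀ i, i < 1 ∨ n < i → a i = 0}

/-- `M̄ n`: the number of closed meandric permutations of order `n`. -/
noncomputable def closedMeanderCount (n : ℕ) : ℕ :=
  Set.ncard {a : ℕ → ℕ | IsClosedMeandricPerm n a ∧ ∀ i, i < 1 ∨ 2 * n < i → a i = 0}

theorem not_arcsCross_iff {p q r s : ℕ} :
    ¬ ArcsCross p q r s ↔ (StrictlyBetween p q r ↔ StrictlyBetween p q s) :=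
  not_xor _ _

/-- The upper and lower conditions in the definition of an open meandric permutation, merged by
comparing the parities of the indices. -/
theorem isOpenMeandricPerm_iff {n : ℕ} {a : ℕ → ℕ} :
    IsOpenMeandricPerm n a ↔
      1 ≤ n ∧
      (∀ i, 1 ≤ i → i ≤ n → 1 ≤ a i ∧ a i ≤ n) ∧
      (∀ i j, 1 ≤ i → i ≤ n → 1 ≤ j → j ≤ n → a i = a j → i = j) ∧
      (∀ i, 1 ≤ i → i ≤ n → a i % 2 = i % 2) ∧
      (∀ i j, 1 ≤ i → i < n → 1 ≤ j → j < n → i % 2 = j % 2 →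
        (StrictlyBetween (a i) (a (i + 1)) (a j) ↔
          StrictlyBetween (a i) (a (i + 1)) (a (j + 1)))) ∧
      (∀ i, 1 ≤ i → i < n → i % 2 = 0 → ¬ StrictlyBetween (a i) (a (i + 1)) (a 1)) ∧
      (∀ i, 1 ≤ i → i < n → i % 2 = n % 2 → ¬ StrictlyBetween (a i) (a (i + 1)) (a n)) := by
  simp only [IsOpenMeandricPerm, not_arcsCross_iff, Nat.even_iff, Nat.odd_iff]
  constructor
  · rintro ⟨hn, hr, hi, hp, hU, hL, h1, h2⟩
    refine ⟨hn, hr, hi, hp, fun i j hi1 hin hj1 hjn hij => ?_,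
      fun i hi1 hin he => h1 i he hi1 hin, fun i hi1 hin he => ?_⟩
    · rcases Nat.mod_two_eq_zero_or_one i with h | h
      · exact hL i j h hi1 hin (by omega) hj1 hjn
      · exact hU i j h hin (by omega) hjn
    · split_ifs at h2 with h
      · exact h2 i (by omega) hi1 hin
      · exact h2 i (by omega) hin
  · rintro ⟨hn, hr, hi, hp, hC, h1, h2⟩
    refine ⟨hn, hr, hi, hp, fun i j hi1 hin hj1 hjn => ?_, fun i j hi0 hi1 hin hj0 hj1 hjn => ?_,
      fun i he hi1 hin => h1 i hi1 hin he, ?_⟩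
    · exact hC i j (by omega) hin (by omega) hjn (by omega)
    · exact hC i j hi1 hin hj1 hjn (by omega)
    · split_ifs with h
      · exact fun i he hi1 hin => h2 i hi1 hin (by omega)
      · exact fun i he hin => h2 i (by omega) hin (by omega)

/-- For arcs without common endpoints, crossing is a symmetric relation. -/
theorem StrictlyBetween.iff_symm {p q r s : ℕ} (hpr : p ≠ r) (hps : p ≠ s) (hqr : q ≠ r)
    (hqs : q ≠ s) (h : StrictlyBetween p q r ↔ StrictlyBetween p q s) :
    StrictlyBetween r s p ↔ StrictlyBetween r s q := by
  unfold StrictlyBetween at *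
  omega

theorem StrictlyBetween.add_left_iff {d p q r : ℕ} :
    StrictlyBetween (d + p) (d + q) (d + r) ↔ StrictlyBetween p q r := by
  unfold StrictlyBetween
  omega

/-- The monotone map contracting the block `A, …, A + m - 1` to the point `A` sends `p` to `x`. -/
def CollapsesTo (A m p x : ℕ) : Prop :=
  x < A ∧ p = x ∨ A < x ∧ p = x + m - 1 ∨ x = A ∧ A ≤ p ∧ p < A + m

theorem CollapsesTo.strictlyBetween_iff {A m p q r x y z : ℕ} (hm : 1 ≤ m)
    (hp : CollapsesTo A m p x) (hq : CollapsesTo A m q y) (hr : CollapsesTo A m r z)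
    (hx : z ≠ x) (hy : z ≠ y) :
    StrictlyBetween p q r ↔ StrictlyBetween x y z := by
  unfold CollapsesTo StrictlyBetween at *
  omega

/-- The index in the outer meander corresponding to the index `i` of the insert of a meander of
order `m` at position `k`. -/
def collapseIndex (k m i : ℕ) : ℕ :=
  if i < k then i else if i ≤ k - 1 + m then k else i - m + 1

/-- Inserting an open meandric permutation of odd order `m` into
an open meandric permutation of order `n` at the point `a k` yields an open
meandric permutation of order `n + m - 1`. -/
theorem insert_odd_isOpenMeandricPerm (n m k : ℕ) (a b : ℕ → ℕ)
    (ha : IsOpenMeandricPerm n a) (hm : Odd m) (hb : IsOpenMeandricPerm m b)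
    (hk₁ : 1 ≤ k) (hk₂ : k ≤ n) (c : ℕ → ℕ)
    (hc : ∀ i, c i =
      if i < k then (if a i < a k then a i else a i + m - 1)
      else if i ≤ k - 1 + m then a k - 1 + b (i - k + 1)
      else (if a (i - m + 1) < a k then a (i - m + 1) else a (i - m + 1) + m - 1)) :
    IsOpenMeandricPerm (n + m - 1) c := by
  have hm2 := Nat.odd_iff.1 hm
  obtain ⟨hn, har, hai, hap, haC, ha1, ha2⟩ := isOpenMeandricPerm_iff.1 ha
  obtain ⟨hm1, hbr, hbi, hbp, hbC, hb1, hb2⟩ := isOpenMeandricPerm_iff.1 hb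
  have hAk := har k hk₁ hk₂
  have hAp := hap k hk₁ hk₂
  have hblock : ∀ s, 1 ≤ s → s ≤ m → c (k - 1 + s) = a k - 1 + b s := fun s hs hsm => by
    rw [hc, if_neg (by omega), if_pos (by omega), show k - 1 + s - k + 1 = s by omega]
  have hidx : ∀ i, 1 ≤ i → i ≤ n + m - 1 →
      1 ≤ collapseIndex k m i ∧ collapseIndex k m i ≤ n := fun i hi hin => by
    unfold collapseIndex
    split_ifs <;> omega
  have hcol : ∀ i, 1 ≤ i → i ≤ n + m - 1 →
      CollapsesTo (a k) m (c i) (a (collapseIndex k m i)) := fun i hi hin => by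
    rw [hc]
    unfold CollapsesTo collapseIndex
    split_ifs with h1 h2 h2 h3
    · omega
    · have := hai i k hi (by omega) hk₁ hk₂
      omega
    · have := hbr (i - k + 1) (by omega) (by omega)
      omega
    · omega
    · have := hai (i - m + 1) k (by omega) (by omega) hk₁ hk₂
      omega
  have hinj : ∀ i j, 1 ≤ i → i ≤ n + m - 1 → 1 ≤ j → j ≤ n + m - 1 → c i = c j → i = j := by
    intro i j hi hin hj hjn hij
    have hφ : collapseIndex k m i = collapseIndex k m j := by
      have hci := hcol i hi hin
      have hcj := hcol j hj hjn
      obtain ⟨hi1, hi2⟩ := hidx i hi hin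
      obtain ⟨hj1, hj2⟩ := hidx j hj hjn
      refine hai _ _ hi1 hi2 hj1 hj2 ?_
      unfold CollapsesTo at hci hcj
      omega
    by_cases hb' : k ≤ i ∧ i ≤ k - 1 + m ∧ k ≤ j ∧ j ≤ k - 1 + m
    · have h1 := hblock (i - k + 1) (by omega) (by omega)
      have h2 := hblock (j - k + 1) (by omega) (by omega)
      rw [show k - 1 + (i - k + 1) = i by omega] at h1
      rw [show k - 1 + (j - k + 1) = j by omega] at h2
      have := hbi (i - k + 1) (j - k + 1) (by omega) (by omega) (by omega) (by omega) (by omega)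
      omega
    · unfold collapseIndex at hφ
      split_ifs at hφ <;> omega
  have harc : ∀ i j, 1 ≤ i → i < n + m - 1 → 1 ≤ j → j ≤ n + m - 1 →
      collapseIndex k m j ≠ collapseIndex k m i →
      collapseIndex k m j ≠ collapseIndex k m (i + 1) →
      (StrictlyBetween (c i) (c (i + 1)) (c j) ↔
        StrictlyBetween (a (collapseIndex k m i)) (a (collapseIndex k m (i + 1)))
          (a (collapseIndex k m j))) := by
    intro i j hi hin hj hjn h1 h2
    have hi' := hidx i hi (by omega)
    have hi'' := hidx (i + 1) (by omega) (by omega)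
    have hj' := hidx j hj hjn
    exact CollapsesTo.strictlyBetween_iff hm1 (hcol i hi (by omega))
      (hcol (i + 1) (by omega) (by omega)) (hcol j hj hjn)
      (fun h => h1 (hai _ _ hj'.1 hj'.2 hi'.1 hi'.2 h))
      (fun h => h2 (hai _ _ hj'.1 hj'.2 hi''.1 hi''.2 h))
  have houter : ∀ i, 1 ≤ i → i < n + m - 1 → ¬ (k ≤ i ∧ i < k - 1 + m) →
      1 ≤ collapseIndex k m i ∧ collapseIndex k m i < n ∧
      collapseIndex k m i % 2 = i % 2 ∧
      collapseIndex k m (i + 1) = collapseIndex k m i + 1 := by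
    intro i hi hin hib
    unfold collapseIndex
    split_ifs <;> omega
  have hinner : ∀ s t, 1 ≤ s → s < m → 1 ≤ t → t ≤ m →
      (StrictlyBetween (c (k - 1 + s)) (c (k - 1 + s + 1)) (c (k - 1 + t)) ↔
        StrictlyBetween (b s) (b (s + 1)) (b t)) := by
    intro s t hs hsm ht htm
    rw [add_assoc, hblock s hs hsm.le, hblock (s + 1) (by omega) (by omega), hblock t ht htm]
    exact StrictlyBetween.add_left_iff
  have hinner_not : ∀ s j, 1 ≤ s → s < m → 1 ≤ j → j ≤ n + m - 1 →
      (j < k ∨ k - 1 + m < j) →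
      ¬ StrictlyBetween (c (k - 1 + s)) (c (k - 1 + s + 1)) (c j) := by
    intro s j hs hsm hj hjn hjb
    have h1 : collapseIndex k m (k - 1 + s) = k := by
      unfold collapseIndex
      split_ifs <;> omega
    have h2 : collapseIndex k m (k - 1 + s + 1) = k := by
      unfold collapseIndex
      split_ifs <;> omega
    have h3 : collapseIndex k m j ≠ k := by
      unfold collapseIndex
      split_ifs <;> omega
    rw [harc _ j (by omega) (by omega) hj hjn (by rwa [h1]) (by rwa [h2]), h1, h2]
    unfold StrictlyBetween
    omega
  have hinner_first : ∀ s, 1 ≤ s → s < m → s % 2 = 0 →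
      ¬ StrictlyBetween (c (k - 1 + s)) (c (k - 1 + s + 1)) (c k) := by
    intro s hs hsm he
    have := hinner s 1 hs hsm le_rfl hm1
    rw [show k - 1 + 1 = k by omega] at this
    exact this.not.2 (hb1 s hs hsm he)
  have hinner_last : ∀ s, 1 ≤ s → s < m → s % 2 = 1 →
      ¬ StrictlyBetween (c (k - 1 + s)) (c (k - 1 + s + 1)) (c (k - 1 + m)) :=
    fun s hs hsm ho => (hinner s m hs hsm hm1 le_rfl).not.2 (hb2 s hs hsm (by omega))
  have hinner_arc : ∀ s j, 1 ≤ s → s < m → 1 ≤ j → j < n + m - 1 → (k - 1 + s) % 2 = j % 2 →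
      (StrictlyBetween (c (k - 1 + s)) (c (k - 1 + s + 1)) (c j) ↔
        StrictlyBetween (c (k - 1 + s)) (c (k - 1 + s + 1)) (c (j + 1))) := by
    intro s j hs hsm hj hjn hp
    by_cases hjb : k ≤ j ∧ j < k - 1 + m
    · obtain ⟨t, rfl⟩ : ∃ t, j = k - 1 + t := ⟨j - (k - 1), by omega⟩
      rw [hinner s t hs hsm (by omega) (by omega), add_assoc (k - 1) t,
        hinner s (t + 1) hs hsm (by omega) (by omega)]
      exact hbC s t hs hsm (by omega) (by omega) (by omega)
    · refine iff_of_false ?_ ?_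
      · rcases eq_or_ne j (k - 1 + m) with rfl | hne
        · exact hinner_last s hs hsm (by omega)
        · exact hinner_not s j hs hsm hj hjn.le (by omega)
      · rcases eq_or_ne (j + 1) k with h | hne
        · rw [h]
          exact hinner_first s hs hsm (by omega)
        · exact hinner_not s (j + 1) hs hsm (by omega) (by omega) (by omega)
  refine isOpenMeandricPerm_iff.2 ⟨by omega, fun i hi hin => ?_, hinj, fun i hi hin => ?_,
    fun i j hi hin hj hjn hp => ?_, fun i hi hin he => ?_, fun i hi hin he => ?_⟩
  · have h1 := hcol i hi hin
    obtain ⟨h2, h3⟩ := hidx i hi hin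
    have h4 := har _ h2 h3
    unfold CollapsesTo at h1
    omega
  · by_cases hib : k ≤ i ∧ i ≤ k - 1 + m
    · obtain ⟨t, rfl⟩ : ∃ t, i = k - 1 + t := ⟨i - (k - 1), by omega⟩
      have h1 := hblock t (by omega) (by omega)
      have h2 := hbp t (by omega) (by omega)
      omega
    · have h1 := hcol i hi hin
      obtain ⟨h2, h3⟩ := hidx i hi hin
      have h4 := hap _ h2 h3
      have h5 : collapseIndex k m i ≠ k ∧ collapseIndex k m i % 2 = i % 2 := by
        unfold collapseIndex
        split_ifs <;> omega
      have h6 := mt (hai _ _ h2 h3 hk₁ hk₂) h5.1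
      unfold CollapsesTo at h1
      omega
  · rcases eq_or_ne i j with rfl | hij
    · unfold StrictlyBetween
      omega
    by_cases hib : k ≤ i ∧ i < k - 1 + m
    · obtain ⟨s, rfl⟩ : ∃ s, i = k - 1 + s := ⟨i - (k - 1), by omega⟩
      exact hinner_arc s j (by omega) (by omega) hj hjn hp
    by_cases hjb : k ≤ j ∧ j < k - 1 + m
    · obtain ⟨s, rfl⟩ : ∃ s, j = k - 1 + s := ⟨j - (k - 1), by omega⟩
      have hne : ∀ x y, 1 ≤ x → x ≤ n + m - 1 → 1 ≤ y → y ≤ n + m - 1 → x ≠ y → c x ≠ c y :=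
        fun x y hx hxn hy hyn => mt (hinj x y hx hxn hy hyn)
      refine StrictlyBetween.iff_symm ?_ ?_ ?_ ?_
        (hinner_arc s i (by omega) (by omega) hi hin hp.symm) <;>
      exact hne _ _ (by omega) (by omega) (by omega) (by omega) (by omega)
    · obtain ⟨hi1, hi2, hi3, hi4⟩ := houter i hi hin hib
      obtain ⟨hj1, hj2, hj3, hj4⟩ := houter j hj hjn hjb
      have hφ : collapseIndex k m i ≠ collapseIndex k m j := by
        unfold collapseIndex
        split_ifs <;> omega
      rw [harc i j hi hin hj hjn.le (by omega) (by omega),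
        harc i (j + 1) hi hin (by omega) (by omega) (by omega) (by omega), hi4, hj4]
      exact haC _ _ hi1 hi2 hj1 hj2 (by omega)
  · by_cases hib : k ≤ i ∧ i < k - 1 + m
    · obtain ⟨s, rfl⟩ : ∃ s, i = k - 1 + s := ⟨i - (k - 1), by omega⟩
      rcases eq_or_ne 1 k with h | hne
      · have := hinner_first s (by omega) (by omega) (by omega)
        rwa [← h] at this ⊢
      · exact hinner_not s 1 (by omega) (by omega) le_rfl (by omega) (by omega)
    · obtain ⟨hi1, hi2, hi3, hi4⟩ := houter i hi hin hib
      have h1 : collapseIndex k m 1 = 1 := by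
        unfold collapseIndex
        split_ifs <;> omega
      rw [harc i 1 hi hin le_rfl (by omega) (by omega) (by omega), hi4, h1]
      exact ha1 _ hi1 hi2 (by omega)
  · by_cases hib : k ≤ i ∧ i < k - 1 + m
    · obtain ⟨s, rfl⟩ : ∃ s, i = k - 1 + s := ⟨i - (k - 1), by omega⟩
      rcases eq_or_ne (n + m - 1) (k - 1 + m) with h | hne
      · rw [h]
        exact hinner_last s (by omega) (by omega) (by omega)
      · exact hinner_not s _ (by omega) (by omega) (by omega) le_rfl (by omega)
    · obtain ⟨hi1, hi2, hi3, hi4⟩ := houter i hi hin hib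
      have h1 : collapseIndex k m (n + m - 1) = n := by
        unfold collapseIndex
        split_ifs <;> omega
      rw [harc i _ hi hin (by omega) le_rfl (by omega) (by omega), hi4, h1]
      exact ha2 _ hi1 hi2 (by omega)
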